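/- Let T be a measure preserving action of the integer Heisenberg group H₃(ℤ) on a σ-finite standard measure space (X, μ). Then the set 𝓡(T) of recurrent directions of T is a G_δ-subset of the projective space P(ℝ³). -/

import Mathlib

open MeasureTheory Filter Set Topology

noncomputable section

instance : TopologicalSpace (Projectivization ℝ (ℝ × ℝ × ℝ)) :=
  inferInstanceAs (TopologicalSpace (Quotient _))

/-- Multiplication of the (integer) Heisenberg group `H₃`, on triples. -/
def hMul (a b : ℤ × ℤ × ℤ) : ℤ × ℤ × ℤ :=
  (a.1 + b.1, a.2.1 + b.2.1, a.2.2 + b.2.2 + a.1 * b.2.1)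

/-- The embedding of `H₃(ℤ)` into `H₃(ℝ)`. -/
def hCast (a : ℤ × ℤ × ℤ) : ℝ × ℝ × ℝ := ((a.1 : ℝ), (a.2.1 : ℝ), (a.2.2 : ℝ))

/-- The right-invariant metric on `H₃(ℝ)`:
`d((t₁,t₂,t₃),(t₁',t₂',t₃')) = |t₁−t₁'| + |t₂−t₂'| + |t₃−t₃'+t₂'(t₁'−t₁)|`. -/
def hDist (t t' : ℝ × ℝ × ℝ) : ℝ :=
  |t.1 - t'.1| + |t.2.1 - t'.2.1| + |t.2.2 - t'.2.2 + t'.2.1 * (t'.1 - t.1)|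

/-- The exponential map of `H₃(ℝ)`, identifying the Lie algebra with `ℝ³`:
`exp(α,β,γ) = (α, β, γ + αβ/2)`. -/
def hExp (v : ℝ × ℝ × ℝ) : ℝ × ℝ × ℝ := (v.1, v.2.1, v.2.2 + v.1 * v.2.1 / 2)

/-- The one-parameter subgroup `exp(θ)` of `H₃(ℝ)` associated with a line `θ ∈ P(ℝ³)`. -/
def expLine (θ : Projectivization ℝ (ℝ × ℝ × ℝ)) : Set (ℝ × ℝ × ℝ) :=
  hExp '' (θ.submodule : Set (ℝ × ℝ × ℝ))

/-- `T` is a measure preserving action of `H₃(ℤ)` on `(X, μ)`. -/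
def IsH3Action {X : Type*} [MeasurableSpace X] (μ : Measure X)
    (T : ℤ × ℤ × ℤ → X ≃ᵐ X) : Prop :=
  (∀ a b : ℤ × ℤ × ℤ, ∀ x : X, T (hMul a b) x = T a (T b x)) ∧
    ∀ a : ℤ × ℤ × ℤ, MeasurePreserving (T a) μ μ

/-- The action `T` of `H₃(ℤ)` is free. -/
def IsH3Free {X : Type*} [MeasurableSpace X] (μ : Measure X)
    (T : ℤ × ℤ × ℤ → X ≃ᵐ X) : Prop :=
  ∀ a : ℤ × ℤ × ℤ, a ≠ 0 → ∀ᵐ x ∂μ, T a x ≠ x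

/-- The action `T` of `H₃(ℤ)` is recurrent along the line `θ ∈ P(ℝ³)`. -/
def H3RecurrentAlong {X : Type*} [MeasurableSpace X] (μ : Measure X)
    (T : ℤ × ℤ × ℤ → X ≃ᵐ X) (θ : Projectivization ℝ (ℝ × ℝ × ℝ)) : Prop :=
  ∀ ε : ℝ, 0 < ε → ∀ A : Set X, MeasurableSet A → 0 < μ A →
    ∃ γ : ℤ × ℤ × ℤ, γ ≠ 0 ∧ ∃ g ∈ expLine θ, hDist (hCast γ) g < ε ∧ 0 < μ (A ∩ T γ '' A)

/-- The set `𝓡(T)` of recurrent directions of an `H₃(ℤ)`-action. -/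
def h3RecSet {X : Type*} [MeasurableSpace X] (μ : Measure X)
    (T : ℤ × ℤ × ℤ → X ≃ᵐ X) : Set (Projectivization ℝ (ℝ × ℝ × ℝ)) :=
  {θ | H3RecurrentAlong μ T θ}

/-- The action `T` of `H₃(ℤ)` is rigid along the line `θ ∈ P(ℝ³)`. -/
def H3RigidAlong {X : Type*} [MeasurableSpace X] (μ : Measure X)
    (T : ℤ × ℤ × ℤ → X ≃ᵐ X) (θ : Projectivization ℝ (ℝ × ℝ × ℝ)) : Prop :=
  ∃ γ : ℕ → ℤ × ℤ × ℤ,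
    Tendsto (fun n => ‖hCast (γ n)‖) atTop atTop ∧
    Tendsto (fun n => ⨅ g ∈ expLine θ, hDist (hCast (γ n)) g) atTop (𝓝 0) ∧
    ∀ A : Set X, MeasurableSet A → μ A < ⊤ →
      Tendsto (fun n => μ (A ∩ T (γ n) '' A)) atTop (𝓝 (μ A))

/-- The set `𝓡i(T)` of rigid directions of an `H₃(ℤ)`-action. -/
def h3RigSet {X : Type*} [MeasurableSpace X] (μ : Measure X)
    (T : ℤ × ℤ × ℤ → X ≃ᵐ X) : Set (Projectivization ℝ (ℝ × ℝ × ℝ)) :=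
  {θ | H3RigidAlong μ T θ}

/-- The adjoint action of `g ∈ H₃(ℝ)` on the Lie algebra `ℝ³`:
`(x,y,z)·(α,β,γ) = (α, β, γ + xβ − yα)`, as a linear map. -/
def adjLin (g : ℝ × ℝ × ℝ) : (ℝ × ℝ × ℝ) →ₗ[ℝ] (ℝ × ℝ × ℝ) where
  toFun v := (v.1, v.2.1, v.2.2 + g.1 * v.2.1 - g.2.1 * v.1)
  map_add' v w := by
    refine Prod.ext_iff.mpr ⟨rfl, Prod.ext_iff.mpr ⟨rfl, ?_⟩⟩
    simp [Prod.fst_add, Prod.snd_add]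
    ring
  map_smul' c v := by
    refine Prod.ext_iff.mpr ⟨rfl, Prod.ext_iff.mpr ⟨rfl, ?_⟩⟩
    simp [Prod.smul_fst, Prod.smul_snd, smul_eq_mul]
    ring

lemma adjLin_injective (g : ℝ × ℝ × ℝ) : Function.Injective (adjLin g) := by
  intro v w h
  have h' : (v.1, v.2.1, v.2.2 + g.1 * v.2.1 - g.2.1 * v.1) =
      (w.1, w.2.1, w.2.2 + g.1 * w.2.1 - g.2.1 * w.1) := h
  obtain ⟨h1, h2, h3⟩ : v.1 = w.1 ∧ v.2.1 = w.2.1 ∧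
      v.2.2 + g.1 * v.2.1 - g.2.1 * v.1 = w.2.2 + g.1 * w.2.1 - g.2.1 * w.1 := by
    simpa [Prod.ext_iff] using h'
  have h4 : v.2.2 = w.2.2 := by rw [h1, h2] at h3; linarith
  exact Prod.ext_iff.mpr ⟨h1, Prod.ext_iff.mpr ⟨h2, h4⟩⟩

/-- The adjoint action of `H₃(ℝ)` on the projective space `P(ℝ³)`. -/
def adjProj (g : ℝ × ℝ × ℝ) :
    Projectivization ℝ (ℝ × ℝ × ℝ) → Projectivization ℝ (ℝ × ℝ × ℝ) :=
  Projectivization.map (adjLin g) (adjLin_injective g)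

/-- The action `T` of `H₃(ℤ)` is evenly recurrent along `θ`: it is recurrent along every line
in the `H₃(ℝ)`-orbit of `θ` under the adjoint action. -/
def H3EvenRecurrentAlong {X : Type*} [MeasurableSpace X] (μ : Measure X)
    (T : ℤ × ℤ × ℤ → X ≃ᵐ X) (θ : Projectivization ℝ (ℝ × ℝ × ℝ)) : Prop :=
  ∀ g : ℝ × ℝ × ℝ, H3RecurrentAlong μ T (adjProj g θ)

/-- The action `T` of `H₃(ℤ)` is evenly rigid along `θ`. -/
def H3EvenRigidAlong {X : Type*} [MeasurableSpace X] (μ : Measure X)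
    (T : ℤ × ℤ × ℤ → X ≃ᵐ X) (θ : Projectivization ℝ (ℝ × ℝ × ℝ)) : Prop :=
  ∀ g : ℝ × ℝ × ℝ, H3RigidAlong μ T (adjProj g θ)

/-- The line `θ_t ∈ P(ℝ³)` through the vector `(1, 0, t)`. -/
def thetaLine (t : ℝ) : Projectivization ℝ (ℝ × ℝ × ℝ) :=
  Projectivization.mk ℝ (1, 0, t) (by simp [Prod.ext_iff])

/-- The line `θ_∞ ∈ P(ℝ³)` through the vector `(0, 0, 1)`. -/
def thetaInf : Projectivization ℝ (ℝ × ℝ × ℝ) :=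
  Projectivization.mk ℝ (0, 0, 1) (by simp [Prod.ext_iff])

section Returns

variable {X ι : Type*}

/-- Remove from `B` every point which `f` moves from `B` to `B`, together with its image. -/
def removeReturns (f : X → X) (B : Set X) : Set X :=
  B \ ((B ∩ f ⁻¹' B) ∪ f '' (B ∩ f ⁻¹' B))

/-- Apply `removeReturns` successively along a list of transformations. -/
def removeReturnsList (f : ι → X → X) (L : List ι) (B : Set X) : Set X :=
  L.foldl (fun C i => removeReturns (f i) C) B

lemma removeReturnsList_subset (f : ι → X → X) (L : List ι) (B : Set X) :
    removeReturnsList f L B ⊆ B := by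
  induction L generalizing B with
  | nil => exact subset_rfl
  | cons i L ih => exact (ih _).trans sdiff_subset

variable [MeasurableSpace X] {μ : Measure X}

lemma MeasurableSet.removeReturns {B : Set X} (hB : MeasurableSet B) (f : X ≃ᵐ X) :
    MeasurableSet (removeReturns f B) := by
  have h : MeasurableSet (B ∩ f ⁻¹' B) := hB.inter (f.measurable hB)
  exact hB.diff (h.union (f.measurableEmbedding.measurableSet_image.2 h))

lemma MeasurableSet.removeReturnsList {B : Set X} (hB : MeasurableSet B) (T : ι → X ≃ᵐ X)
    (L : List ι) : MeasurableSet (removeReturnsList (fun i => T i) L B) := by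
  induction L generalizing B with
  | nil => exact hB
  | cons i L ih => exact ih (hB.removeReturns (T i))

lemma MeasureTheory.MeasurePreserving.measure_equiv_image {f : X ≃ᵐ X}
    (hf : MeasurePreserving f μ μ) (s : Set X) : μ (f '' s) = μ s := by
  rw [← hf.measure_preimage_equiv (f '' s), f.injective.preimage_image]

lemma measure_diff_removeReturns_le {f : X ≃ᵐ X} (hf : MeasurePreserving f μ μ)
    {A : Set X} (hA : μ (A ∩ f '' A) = 0) (B : Set X) :
    μ (B \ removeReturns f B) ≤ 4 * μ ((B \ removeReturns f B) \ A) := by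
  set E := B ∩ f ⁻¹' B with hE
  have hEB : E ∪ f '' E ⊆ B := by
    rintro x (hx | ⟨y, hy, rfl⟩)
    · exact hx.1
    · exact hy.2
  have hD : B \ removeReturns f B = E ∪ f '' E := sdiff_sdiff_eq_self hEB
  rw [hD]
  set m := μ ((E ∪ f '' E) \ A) with hm
  have h0 : μ (A ∩ f ⁻¹' A) = 0 := by
    rw [← hf.measure_equiv_image]
    refine measure_mono_null ?_ hA
    rintro _ ⟨x, hx, rfl⟩
    exact ⟨hx.2, x, hx.1, rfl⟩
  have hEm : μ E ≤ m + m := by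
    have hsub : E ⊆ ((E \ A) ∪ f ⁻¹' (f '' E \ A)) ∪ (A ∩ f ⁻¹' A) := by
      intro x hx
      by_cases h1 : x ∈ A
      · by_cases h2 : f x ∈ A
        · exact Or.inr ⟨h1, h2⟩
        · exact Or.inl (Or.inr ⟨⟨x, hx, rfl⟩, h2⟩)
      · exact Or.inl (Or.inl ⟨hx, h1⟩)
    calc μ E ≤ μ (E \ A) + μ (f ⁻¹' (f '' E \ A)) + μ (A ∩ f ⁻¹' A) :=
          (measure_mono hsub).trans ((measure_union_le _ _).trans
            (add_le_add_left (measure_union_le _ _) _))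
      _ = μ (E \ A) + μ (f '' E \ A) := by rw [h0, add_zero, hf.measure_preimage_equiv]
      _ ≤ m + m := add_le_add
          (measure_mono (sdiff_subset_sdiff_left subset_union_left))
          (measure_mono (sdiff_subset_sdiff_left subset_union_right))
  calc μ (E ∪ f '' E) ≤ μ E + μ (f '' E) := measure_union_le _ _
    _ = μ E + μ E := by rw [hf.measure_equiv_image]
    _ ≤ (m + m) + (m + m) := add_le_add hEm hEm
    _ = 4 * m := by ring

lemma measure_diff_removeReturnsList_le {T : ι → X ≃ᵐ X}
    (hT : ∀ i, MeasurePreserving (T i) μ μ) {A : Set X} (hAm : MeasurableSet A) {L : List ι}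
    (hA : ∀ i ∈ L, μ (A ∩ T i '' A) = 0) {B : Set X} (hB : MeasurableSet B) :
    μ (B \ removeReturnsList (fun i => T i) L B) ≤
      4 * μ ((B \ removeReturnsList (fun i => T i) L B) \ A) := by
  induction L generalizing B with
  | nil => simp [removeReturnsList]
  | cons i L ih =>
    have hB' := hB.removeReturns (T i)
    set C := removeReturns (T i) B with hC
    have hR : removeReturnsList (fun i => T i) (i :: L) B =
      removeReturnsList (fun i => T i) L C := rfl
    rw [hR]
    have h1 := measure_diff_removeReturns_le (hT i) (hA i (by simp)) B
    have h2 := ih (fun j hj => hA j (by simp [hj])) hB'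
    have hRC := removeReturnsList_subset (fun i => T i) L C
    have hRm := hB'.removeReturnsList T L
    set R := removeReturnsList (fun i => T i) L C
    have hCB : C ⊆ B := sdiff_subset
    have hsplit : B \ R = (B \ C) ∪ (C \ R) :=
      (sdiff_union_sdiff_cancel hCB hRC).symm
    have hdisj : Disjoint ((B \ C) \ A) ((C \ R) \ A) :=
      Set.disjoint_left.2 fun x hx hx' => hx.1.2 hx'.1.1
    rw [hsplit, union_sdiff_distrib, measure_union hdisj ((hB'.diff hRm).diff hAm), mul_add]
    exact (measure_union_le _ _).trans (add_le_add h1 h2)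

lemma exists_list_measure_removeReturnsList_lt {T : ι → X ≃ᵐ X} {S : Set ι} (hS : S.Countable)
    (hrec : ∀ A, MeasurableSet A → 0 < μ A → ∃ i ∈ S, 0 < μ (A ∩ T i '' A))
    {B : Set X} (hB : MeasurableSet B) (hfin : μ B ≠ ⊤) {c : ENNReal} (hc : 0 < c) :
    ∃ L : List ι, (∀ i ∈ L, i ∈ S) ∧ μ (removeReturnsList (fun i => T i) L B) < c := by
  by_cases h0 : μ B = 0
  · exact ⟨[], by simp, by simpa [removeReturnsList, h0] using hc⟩
  have hne : S.Nonempty := by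
    obtain ⟨i, hi, -⟩ := hrec B hB (pos_iff_ne_zero.2 h0)
    exact ⟨i, hi⟩
  obtain ⟨e, rfl⟩ := hS.exists_eq_range hne
  let C : ℕ → Set X := fun n => removeReturnsList (fun i => T i) ((List.range n).map e) B
  have hsucc : ∀ n, C (n + 1) = removeReturns (T (e n)) (C n) := fun n => by
    simp [C, removeReturnsList, List.range_succ]
  have hCm : ∀ n, MeasurableSet (C n) := fun n => hB.removeReturnsList T _
  have hanti : Antitone C := antitone_nat_of_succ_le fun n => by
    rw [hsucc]; exact sdiff_subset
  have hlim : μ (⋂ n, C n) = 0 := by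
    by_contra hpos
    obtain ⟨_, ⟨n, rfl⟩, hn⟩ := hrec _ (MeasurableSet.iInter hCm) (pos_iff_ne_zero.2 hpos)
    obtain ⟨_, hx, y, hy, rfl⟩ := nonempty_of_measure_ne_zero hn.ne'
    have hy' := mem_iInter.1 hy (n + 1)
    rw [hsucc] at hy'
    exact hy'.2 (Or.inl ⟨mem_iInter.1 hy n, mem_iInter.1 hx n⟩)
  have htend := tendsto_measure_iInter_atTop (μ := μ) (fun n => (hCm n).nullMeasurableSet) hanti
    ⟨0, by simpa [C, removeReturnsList] using hfin⟩
  rw [hlim] at htend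
  obtain ⟨n, hn⟩ := (htend.eventually (gt_mem_nhds hc)).exists
  exact ⟨(List.range n).map e, by simp, hn⟩

lemma exists_measure_inter_image_pos_iff {T : ι → X ≃ᵐ X} [SigmaFinite μ]
    (hT : ∀ i, MeasurePreserving (T i) μ μ) {S : Set ι} (hS : S.Countable)
    {𝒜 : Set (Set X)} (h𝒜 : μ.MeasureDense 𝒜) :
    (∀ A, MeasurableSet A → 0 < μ A → ∃ i ∈ S, 0 < μ (A ∩ T i '' A)) ↔
      ∀ B ∈ {B | B ∈ 𝒜 ∧ μ B ≠ ⊤ ∧ μ B ≠ 0}, ∃ L : List ι, (∀ i ∈ L, i ∈ S) ∧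
        μ (removeReturnsList (fun i => T i) L B) < μ B / 2 := by
  constructor
  · rintro hrec B ⟨hB, hfin, hpos⟩
    exact exists_list_measure_removeReturnsList_lt hS hrec (h𝒜.measurable B hB) hfin
      (ENNReal.half_pos hpos)
  · intro h A₀ hA₀ hA₀pos
    obtain ⟨A, hAm, hAA₀, hApos, hAfin⟩ := Measure.exists_subset_measure_lt_top hA₀ hA₀pos
    suffices ∃ i ∈ S, 0 < μ (A ∩ T i '' A) by
      obtain ⟨i, hi, hpos⟩ := this
      exact ⟨i, hi, hpos.trans_le (measure_mono (by gcongr))⟩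
    by_contra! hnull
    have hreal : 0 < μ.real A := ENNReal.toReal_pos hApos.ne' hAfin.ne
    obtain ⟨B, hB, hAB⟩ := h𝒜.approx A hAm hAfin.ne (μ.real A / 16) (by positivity)
    have hBm := h𝒜.measurable B hB
    have hsfin : μ (symmDiff A B) ≠ ⊤ := (hAB.trans ENNReal.ofReal_lt_top).ne
    have hs : μ.real (symmDiff A B) < μ.real A / 16 :=
      (ENNReal.lt_ofReal_iff_toReal_lt hsfin).1 hAB
    have hBsub : B ⊆ A ∪ symmDiff A B := fun x hx => by
      by_cases hxA : x ∈ A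
      · exact Or.inl hxA
      · exact Or.inr (Or.inr ⟨hx, hxA⟩)
    have hBfin : μ B ≠ ⊤ := measure_ne_top_of_subset hBsub
      (measure_union_lt_top hAfin hsfin.lt_top).ne
    have hAsub : A ⊆ B ∪ symmDiff A B := fun x hx => by
      by_cases hxB : x ∈ B
      · exact Or.inl hxB
      · exact Or.inr (Or.inl ⟨hx, hxB⟩)
    have hAle : μ.real A ≤ μ.real B + μ.real (symmDiff A B) :=
      (measureReal_mono hAsub (measure_union_lt_top hBfin.lt_top hsfin.lt_top).ne).trans
        (measureReal_union_le _ _)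
    have hBpos : μ B ≠ 0 := fun h0 => by
      have : μ.real B = 0 := by simp [measureReal_def, h0]
      linarith
    obtain ⟨L, hL, hlt⟩ := h B ⟨hB, hBfin, hBpos⟩
    have hkey := measure_diff_removeReturnsList_le hT hAm
      (fun i hi => le_antisymm (hnull i (hL i hi)) bot_le) hBm (L := L)
    have hRB := removeReturnsList_subset (fun i => T i) L B
    set R := removeReturnsList (fun i => T i) L B
    have hRfin : μ R ≠ ⊤ := measure_ne_top_of_subset hRB hBfin
    have hkey' : μ (B \ R) ≤ 4 * μ (symmDiff A B) := hkey.trans <| by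
      gcongr
      exact fun x hx => Or.inr ⟨hx.1.1, hx.2⟩
    have hkey_real : μ.real (B \ R) ≤ 4 * μ.real (symmDiff A B) := by
      have := ENNReal.toReal_mono (ENNReal.mul_ne_top (by simp) hsfin) hkey'
      simpa [measureReal_def] using this
    have hlt_real : μ.real R < μ.real B / 2 := by
      have := (ENNReal.toReal_lt_toReal hRfin (ENNReal.div_ne_top hBfin (by simp))).2 hlt
      simpa [measureReal_def] using this
    have hBle : μ.real B ≤ μ.real (B \ R) + μ.real R := by
      have := measureReal_union_le (μ := μ) (B \ R) R
      rwa [sdiff_union_of_subset hRB] at this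
    linarith

end Returns

lemma isOpen_setOf_exists_expLine_hDist_lt (p : ℝ × ℝ × ℝ) (ε : ℝ) :
    IsOpen {θ : Projectivization ℝ (ℝ × ℝ × ℝ) | ∃ g ∈ expLine θ, hDist p g < ε} := by
  have hq : Topology.IsQuotientMap (fun v : {v : ℝ × ℝ × ℝ // v ≠ 0} =>
      Projectivization.mk ℝ v.1 v.2) := isQuotientMap_quotient_mk'
  rw [← hq.isOpen_preimage]
  have heq : (fun v : {v : ℝ × ℝ × ℝ // v ≠ 0} => Projectivization.mk ℝ v.1 v.2) ⁻¹'
      {θ | ∃ g ∈ expLine θ, hDist p g < ε} =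
      ⋃ s : ℝ, {v | hDist p (hExp (s • v.1)) < ε} := by
    ext v
    simp only [mem_preimage, mem_ofPred_eq, expLine, exists_mem_image, SetLike.mem_coe,
      Projectivization.submodule_mk, mem_iUnion]
    constructor
    · rintro ⟨w, hw, hlt⟩
      obtain ⟨s, rfl⟩ := Submodule.mem_span_singleton.1 hw
      exact ⟨s, hlt⟩
    · rintro ⟨s, hlt⟩
      exact ⟨_, Submodule.mem_span_singleton.2 ⟨s, rfl⟩, hlt⟩
  rw [heq]
  refine isOpen_iUnion fun s => isOpen_lt ?_ continuous_const
  simp only [hDist, hExp]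
  fun_prop

/-- the set of recurrent directions of a measure preserving `H₃(ℤ)`-action is a
`G_δ`-subset of the projective space `P(ℝ³)`. -/
theorem h3RecSet_isGδ {X : Type*} [MeasurableSpace X] [StandardBorelSpace X]
    (μ : Measure X) [SigmaFinite μ]
    (T : ℤ × ℤ × ℤ → X ≃ᵐ X) (hT : IsH3Action μ T) :
    IsGδ (h3RecSet μ T) := by
  obtain ⟨𝒜, h𝒜c, h𝒜⟩ := exists_countable_measureDense μ
  let near (θ : Projectivization ℝ (ℝ × ℝ × ℝ)) (m : ℕ) : Set (ℤ × ℤ × ℤ) :=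
    {γ | γ ≠ 0 ∧ ∃ g ∈ expLine θ, hDist (hCast γ) g < 1 / (m + 1 : ℝ)}
  let I : Set (Set X) := {B | B ∈ 𝒜 ∧ μ B ≠ ⊤ ∧ μ B ≠ 0}
  have heq : h3RecSet μ T = ⋂ m : ℕ, ⋂ B ∈ I,
      {θ | ∃ L : List (ℤ × ℤ × ℤ), (∀ γ ∈ L, γ ∈ near θ m) ∧
        μ (removeReturnsList (fun γ => T γ) L B) < μ B / 2} := by
    ext θ
    simp only [mem_iInter]
    have hiff (m : ℕ) := exists_measure_inter_image_pos_iff (μ := μ) (T := T) hT.2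
      (near θ m).to_countable h𝒜
    refine Iff.trans ?_ (forall_congr' hiff)
    constructor
    · intro hθ m A hA hpos
      obtain ⟨γ, hγ, g, hg, hd, hAγ⟩ := hθ (1 / (m + 1)) (by positivity) A hA hpos
      exact ⟨γ, ⟨hγ, g, hg, hd⟩, hAγ⟩
    · intro h ε hε A hA hpos
      obtain ⟨m, hm⟩ := exists_nat_one_div_lt hε
      obtain ⟨γ, ⟨hγ, g, hg, hd⟩, hAγ⟩ := h m A hA hpos
      exact ⟨γ, hγ, g, hg, hd.trans hm, hAγ⟩
  rw [heq]
  refine IsGδ.iInter fun m => IsGδ.biInter_of_isOpen (h𝒜c.mono fun B hB => hB.1) fun B _ => ?_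
  simp only [ofPred_exists, ofPred_and]
  refine isOpen_iUnion fun L => IsOpen.inter ?_ isOpen_const
  have hL : {θ | ∀ γ ∈ L, γ ∈ near θ m} = ⋂ γ ∈ {γ | γ ∈ L}, {θ | γ ∈ near θ m} := by
    ext θ
    simp
  rw [hL]
  exact L.finite_toSet.isOpen_biInter fun γ _ =>
    isOpen_const.inter (isOpen_setOf_exists_expLine_hDist_lt (hCast γ) _)
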